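/- Let u* be the unique minimizer of f, let ε > 0 satisfy μ² β^{-2} ε^{2-2α} < 1, set τ = μ β^{-2} ε^{2-2α}, and let {u_k} be defined by u_{k+1} = u_k - τ ∇f(u_k) with ‖u_0 - u*‖ ≤ δ. If k is such that ‖u_j - u*‖ > ε for all 0 ≤ j < k, then ‖u_k - u*‖² ≤ (1 - μ² β^{-2} ε^{2-2α})^k ‖u_0 - u*‖². -/

import Mathlib

open Real Set RealInnerProductSpace

/-- The gradient vanishes at a local minimum. -/
theorem IsLocalMin.gradient_eq_zero {E : Type*} [NormedAddCommGroup E] [InnerProductSpace ℝ E]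
    [CompleteSpace E] {f : E → ℝ} {a : E} (h : IsLocalMin f a) : gradient f a = 0 := by
  rw [gradient, h.fderiv_eq_zero, map_zero]

/-- A gradient step contracts the squared distance to `p` when the direction `g` at `x` satisfies
`μ ‖x - p‖² ≤ ⟪g, x - p⟫` and `τ ‖g‖² ≤ μ ‖x - p‖²`. -/
theorem norm_sub_smul_sub_sq_le {E : Type*} [NormedAddCommGroup E] [InnerProductSpace ℝ E]
    {x p g : E} {μ τ : ℝ} (hτ : 0 ≤ τ) (hinner : μ * ‖x - p‖ ^ 2 ≤ ⟪g, x - p⟫)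
    (hnorm : τ * ‖g‖ ^ 2 ≤ μ * ‖x - p‖ ^ 2) :
    ‖x - τ • g - p‖ ^ 2 ≤ (1 - μ * τ) * ‖x - p‖ ^ 2 := by
  have hexp : ‖x - τ • g - p‖ ^ 2 =
      ‖x - p‖ ^ 2 - 2 * (τ * ⟪g, x - p⟫) + τ * (τ * ‖g‖ ^ 2) := by
    rw [sub_right_comm, norm_sub_sq_real, real_inner_smul_right, real_inner_comm, norm_smul,
      Real.norm_eq_abs, mul_pow, sq_abs]
    ring
  rw [hexp]
  linarith [mul_le_mul_of_nonneg_left hinner hτ, mul_le_mul_of_nonneg_left hnorm hτ]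

theorem rpow_sq_mul_rpow_le_sq {α ε d : ℝ} (hα : α ≤ 1) (hε : 0 < ε) (hd : ε ≤ d) :
    (d ^ α) ^ 2 * ε ^ (2 - 2 * α) ≤ d ^ 2 := by
  have hd0 : 0 < d := hε.trans_le hd
  calc (d ^ α) ^ 2 * ε ^ (2 - 2 * α)
      ≤ (d ^ α) ^ 2 * d ^ (2 - 2 * α) := by
        gcongr
        linarith
    _ = d ^ 2 := by
        rw [← Real.rpow_natCast (d ^ α), ← Real.rpow_mul hd0.le, ← Real.rpow_add hd0,
          ← Real.rpow_natCast d]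
        congr 1
        push_cast
        ring

/-- Linear decrease of the squared distance along gradient descent with stepsize
`τ = μ β^{-2} ε^{2-2α}`, as long as all previous iterates are at distance more than `ε`
from the minimizer: `‖u_k - u*‖² ≤ (1 - μ² β^{-2} ε^{2-2α})^k ‖u_0 - u*‖²`. -/
theorem gradient_descent_linear_decay
    {n : ℕ} (f : EuclideanSpace ℝ (Fin n) → ℝ) (μ : ℝ) (hμ : 0 < μ)
    (hf : ContDiff ℝ 1 f)
    (hsc : ∀ x y : EuclideanSpace ℝ (Fin n),
      f x - f y ≥ ⟪gradient f y, x - y⟫ + μ / 2 * ‖x - y‖ ^ 2)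
    (α β δ : ℝ) (hα : 0 < α) (hα1 : α ≤ 1) (hβ : 0 < β) (hδ : 0 < δ)
    (hH : ∀ x y : EuclideanSpace ℝ (Fin n),
      ‖x - y‖ ≤ δ → ‖gradient f x - gradient f y‖ ≤ β * ‖x - y‖ ^ α)
    (ustar : EuclideanSpace ℝ (Fin n))
    (hmin : ∀ y, f ustar ≤ f y)
    (huniq : ∀ y, (∀ z, f y ≤ f z) → y = ustar)
    (ε : ℝ) (hε : 0 < ε) (hε1 : μ ^ 2 * β ^ (-(2 : ℝ)) * ε ^ (2 - 2 * α) < 1)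
    (τ : ℝ) (hτ : τ = μ * β ^ (-(2 : ℝ)) * ε ^ (2 - 2 * α))
    (uk : ℕ → EuclideanSpace ℝ (Fin n))
    (hukrec : ∀ k : ℕ, uk (k + 1) = uk k - τ • gradient f (uk k))
    (huk0 : ‖uk 0 - ustar‖ ≤ δ)
    (k : ℕ) (hfar : ∀ j : ℕ, j < k → ε < ‖uk j - ustar‖) :
    ‖uk k - ustar‖ ^ 2 ≤
      (1 - μ ^ 2 * β ^ (-(2 : ℝ)) * ε ^ (2 - 2 * α)) ^ k * ‖uk 0 - ustar‖ ^ 2 := by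
  have hgrad : gradient f ustar = 0 :=
    IsLocalMin.gradient_eq_zero (Filter.Eventually.of_forall hmin)
  have hτ0 : 0 < τ := by rw [hτ]; positivity
  have hμτ : μ ^ 2 * β ^ (-(2 : ℝ)) * ε ^ (2 - 2 * α) = μ * τ := by rw [hτ]; ring
  rw [hμτ] at hε1 ⊢
  have hβ2 : β ^ (-(2 : ℝ)) * β ^ 2 = 1 := by
    rw [← Real.rpow_natCast β, ← Real.rpow_add hβ]
    norm_num
  have step : ∀ x, ‖x - ustar‖ ≤ δ → ε < ‖x - ustar‖ →
      ‖x - τ • gradient f x - ustar‖ ^ 2 ≤ (1 - μ * τ) * ‖x - ustar‖ ^ 2 := by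
    intro x hxδ hxε
    apply norm_sub_smul_sub_sq_le hτ0.le
    · have hlow := hsc x ustar
      have hup := hsc ustar x
      rw [hgrad, inner_zero_left] at hlow
      rw [← neg_sub x ustar, inner_neg_right, norm_neg] at hup
      linarith
    · have hg := hH x ustar hxδ
      rw [hgrad, sub_zero] at hg
      calc τ * ‖gradient f x‖ ^ 2
          ≤ τ * (β * ‖x - ustar‖ ^ α) ^ 2 := by gcongr
        _ = μ * (β ^ (-(2 : ℝ)) * β ^ 2) * ((‖x - ustar‖ ^ α) ^ 2 * ε ^ (2 - 2 * α)) := by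
            rw [hτ]; ring
        _ ≤ μ * ‖x - ustar‖ ^ 2 := by
            rw [hβ2, mul_one]
            gcongr
            exact rpow_sq_mul_rpow_le_sq hα1 hε hxε.le
  have hq0 : 0 ≤ 1 - μ * τ := by linarith
  have hq1 : 1 - μ * τ ≤ 1 := by linarith [mul_pos hμ hτ0]
  induction k with
  | zero => simp
  | succ k ih =>
    have hk := ih fun j hj => hfar j (hj.trans k.lt_succ_self)
    have hkδ : ‖uk k - ustar‖ ≤ δ := by
      refine le_trans ?_ huk0
      refine (pow_le_pow_iff_left₀ (norm_nonneg _) (norm_nonneg _) two_ne_zero).mp ?_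
      exact hk.trans (mul_le_of_le_one_left (sq_nonneg _) (pow_le_one₀ hq0 hq1))
    rw [hukrec, pow_succ' (1 - μ * τ), mul_assoc]
    exact (step _ hkδ (hfar k k.lt_succ_self)).trans (mul_le_mul_of_nonneg_left hk hq0)
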